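/- (Relation R3 of the intermediate Wakimoto realization.) For all 1 ≤ i, j ≤ n and all m, p ∈ ℤ, [ρ(H_i)_m, ρ(F_j)_p] = −(α_i|α_j) · ρ(F_j)_{m+p} as linear operators on ℂ[x] ⊗ ℂ[y]. -/

import Mathlib

open MvPolynomial

/-- The Cartan matrix of `sl(n+1, ℂ)` (indices `0, …, n-1` represent `1, …, n`). -/
def cartan (n : ℕ) (i j : Fin n) : ℤ :=
  if i = j then 2 else if (i : ℕ) + 1 = (j : ℕ) ∨ (j : ℕ) + 1 = (i : ℕ) then -1 else 0

/-- The pairing `(α_i | α_{kl}) = Σ_{s=k}^{l} A_{is}` of a simple root with the positive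
root `α_k + ⋯ + α_l`. -/
def pairRoot (n : ℕ) (i k l : Fin n) : ℤ :=
  ∑ s ∈ Finset.Icc k l, cartan n i s

/-- The matrix `𝔅_{ij} = (α_i|α_j)(γ² − δ_{i>r}δ_{j>r}(r+1) + (r/2)δ_{i,r+1}δ_{j,r+1})`. -/
noncomputable def Bmat (n r : ℕ) (γ : ℂ) (i j : Fin n) : ℂ :=
  (cartan n i j : ℂ) *
    (γ ^ 2 - (if r < (i : ℕ) + 1 ∧ r < (j : ℕ) + 1 then (r : ℂ) + 1 else 0)
      + (if (i : ℕ) = r ∧ (j : ℕ) = r then (r : ℂ) / 2 else 0))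

/-- Index type for the variables of `ℂ[x] ⊗ ℂ[y] ≅ ℂ[x, y]`:  left summands index the
variables `x_{ij,m}` (`1 ≤ i ≤ j ≤ n`, `m ∈ ℤ`; only indices with `i ≤ j` are used),
right summands index the variables `y_{i,m}` (`1 ≤ i ≤ n`, `m ≥ 1`). -/
abbrev Idx (n : ℕ) := (Fin n × Fin n × ℤ) ⊕ (Fin n × ℕ+)

/-- The Fock space `ℂ[x] ⊗ ℂ[y]`, realized as a polynomial ring in both families of
variables. -/
abbrev PXY (n : ℕ) := MvPolynomial (Idx n) ℂ

/-- The oscillator operator `a_{ij,m} ⊗ 1`. -/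
noncomputable def aOp (n r : ℕ) (i j : Fin n) (m : ℤ) : Module.End ℂ (PXY n) :=
  if 0 ≤ m ∧ (j : ℕ) + 1 ≤ r then (pderiv (Sum.inl (i, j, m))).toLinearMap
  else LinearMap.mulLeft ℂ (X (Sum.inl (i, j, m)))

/-- The oscillator operator `a*_{ij,m} ⊗ 1`. -/
noncomputable def aStar (n r : ℕ) (i j : Fin n) (m : ℤ) : Module.End ℂ (PXY n) :=
  if m ≤ 0 ∧ (j : ℕ) + 1 ≤ r then LinearMap.mulLeft ℂ (X (Sum.inl (i, j, -m)))
  else - (pderiv (Sum.inl (i, j, -m))).toLinearMap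

/-- The Heisenberg operator `1 ⊗ b_{i,m}`. -/
noncomputable def bOp (n : ℕ) (e : Fin n → Fin n → ℂ) (lam : Fin n → ℂ)
    (i : Fin n) (m : ℤ) : Module.End ℂ (PXY n) :=
  if hm : 0 < m then
    (m : ℂ) • ∑ k : Fin n, e i k • (pderiv (Sum.inr (k, (⟨m.toNat, by omega⟩ : ℕ+)))).toLinearMap
  else if hm' : m < 0 then
    ∑ k : Fin n, e i k • LinearMap.mulLeft ℂ (X (Sum.inr (k, (⟨(-m).toNat, by omega⟩ : ℕ+))))
  else lam i • (1 : Module.End ℂ (PXY n))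

/-- The normally ordered quadratic operator `N_{kl,m} = Σ_{q∈ℤ} :a_{kl,q} a*_{kl,m-q}:`
(pointwise `finsum`). -/
noncomputable def Nop (n r : ℕ) (k l : Fin n) (m : ℤ) (P : PXY n) : PXY n :=
  ∑ᶠ q : ℤ,
    if 0 ≤ q ∧ (l : ℕ) + 1 ≤ r then aStar n r k l (m - q) (aOp n r k l q P)
    else aOp n r k l q (aStar n r k l (m - q) P)

/-- The operator `ℋ_{i,m} = Σ_{1 ≤ k ≤ l ≤ n} (α_i|α_{kl}) N_{kl,m}`. -/
noncomputable def Hcal (n r : ℕ) (i : Fin n) (m : ℤ) (P : PXY n) : PXY n :=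
  ∑ k : Fin n, ∑ l : Fin n,
    if k ≤ l then (pairRoot n i k l : ℂ) • Nop n r k l m P else 0

/-- The quadratic operator `(a_{kl} a*_{k'l'})_m = Σ_{q∈ℤ} a_{kl,q} a*_{k'l',m-q}`. -/
noncomputable def pairOp (n r : ℕ) (k l k' l' : Fin n) (m : ℤ) (P : PXY n) : PXY n :=
  ∑ᶠ q : ℤ, aOp n r k l q (aStar n r k' l' (m - q) P)

/-- `Σ_{k=1}^{i-1} (a_{k,i-1} a*_{k,i})_m`. -/
noncomputable def sumLow (n r : ℕ) (i : Fin n) (m : ℤ) (P : PXY n) : PXY n :=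
  ∑ k : Fin n, if h : k < i then
    pairOp n r k (⟨(i : ℕ) - 1, by have := i.isLt; omega⟩ : Fin n) k i m P
  else 0

/-- `Σ_{k=i+1}^{n} (a_{i+1,k} a*_{i,k})_m`. -/
noncomputable def sumHigh (n r : ℕ) (i : Fin n) (m : ℤ) (P : PXY n) : PXY n :=
  ∑ k : Fin n, if h : i < k then
    pairOp n r (⟨(i : ℕ) + 1, by have := k.isLt; have := Fin.lt_def.mp h; omega⟩ : Fin n)
      k i k m P
  else 0

/-- `Σ_{j=i+1}^{n} (a_{i,j} a*_{i+1,j})_m`, the quadratic part of `ρ(F_i)_m`. -/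
noncomputable def sumF (n r : ℕ) (i : Fin n) (m : ℤ) (P : PXY n) : PXY n :=
  ∑ j : Fin n, if h : i < j then
    pairOp n r i j (⟨(i : ℕ) + 1, by have := j.isLt; have := Fin.lt_def.mp h; omega⟩ : Fin n)
      j m P
  else 0

/-- `a_{jl,q}` is an annihilation operator iff `q ≥ 0` and `l ≤ r`. -/
def annAFlag (r : ℕ) {n : ℕ} (l : Fin n) (q : ℤ) : Bool :=
  decide (0 ≤ q ∧ (l : ℕ) + 1 ≤ r)

/-- `a*_{jl,q}` is an annihilation operator iff `q > 0` or `l > r`. -/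
def annSFlag (r : ℕ) {n : ℕ} (l : Fin n) (q : ℤ) : Bool :=
  ! decide (q ≤ 0 ∧ (l : ℕ) + 1 ≤ r)

/-- Normally ordered product of three operators (each tagged with its annihilation flag):
annihilation operators are placed to the right of creation operators. -/
noncomputable def nord3 {n : ℕ} (f1 f2 f3 : Module.End ℂ (PXY n) × Bool) :
    Module.End ℂ (PXY n) :=
  (([f1, f2, f3].filter fun p => !p.2).map Prod.fst).prod *
    (([f1, f2, f3].filter fun p => p.2).map Prod.fst).prod

/-- The mode of `:a*_{ii}(z) a_{kl}(z) a*_{kl}(z):` of `z`-degree `-m-1`. -/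
noncomputable def cubic (n r : ℕ) (i k l : Fin n) (m : ℤ) (P : PXY n) : PXY n :=
  ∑ᶠ q : ℤ × ℤ,
    nord3 (aStar n r i i q.1, annSFlag r i q.1)
      (aOp n r k l q.2, annAFlag r l q.2)
      (aStar n r k l (m - q.1 - q.2), annSFlag r l (m - q.1 - q.2)) P

/-- The mode `ρ(E_i)_m`, the coefficient of `z^{-m-1}` in
`E_i(z) = :a*_{ii}(Σ_{k<i} a_{k,i-1}a*_{k,i-1} − Σ_{k≤i} a_{ki}a*_{ki}):
+ Σ_{k>i} a_{i+1,k}a*_{ik} − Σ_{k<i} a_{k,i-1}a*_{ki} − a*_{ii} b_i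
− (δ_{i>r}(r+1) + δ_{i≤r}(i+1) − γ²) ∂a*_{ii}`. -/
noncomputable def rhoE (n r : ℕ) (γ : ℂ) (e : Fin n → Fin n → ℂ) (lam : Fin n → ℂ)
    (i : Fin n) (m : ℤ) (P : PXY n) : PXY n :=
  (∑ k : Fin n, if h : k < i then
      cubic n r i k (⟨(i : ℕ) - 1, by have := i.isLt; omega⟩ : Fin n) m P
    else 0)
  - (∑ k : Fin n, if k ≤ i then cubic n r i k i m P else 0)
  + sumHigh n r i m P
  - sumLow n r i m P
  - (∑ᶠ q : ℤ, aStar n r i i q (bOp n e lam i (m - q) P))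
  - ((if r < (i : ℕ) + 1 then (r : ℂ) + 1 else 0)
      + (if (i : ℕ) + 1 ≤ r then ((i : ℕ) : ℂ) + 2 else 0) - γ ^ 2) •
      ((-(m : ℂ)) • aStar n r i i m P)

/-- The mode `ρ(H_i)_m = ℋ_{i,m} ⊗ 1 + 1 ⊗ b_{i,m}`. -/
noncomputable def rhoH (n r : ℕ) (e : Fin n → Fin n → ℂ) (lam : Fin n → ℂ)
    (i : Fin n) (m : ℤ) (P : PXY n) : PXY n :=
  Hcal n r i m P + bOp n e lam i m P

/-- The mode `ρ(F_i)_m = a_{ii,m} ⊗ 1 + Σ_{j=i+1}^{n} (a_{ij} a*_{i+1,j})_m ⊗ 1`. -/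
noncomputable def rhoF (n r : ℕ) (i : Fin n) (m : ℤ) (P : PXY n) : PXY n :=
  aOp n r i i m P + sumF n r i m P

section

attribute [local instance] LieRing.ofAssociativeRing

theorem end_smul_lie {V : Type*} [AddCommGroup V] [Module ℂ V] (c : ℂ) (A B : Module.End ℂ V) :
    ⁅c • A, B⁆ = c • ⁅A, B⁆ := by
  simp [Ring.lie_def, smul_sub]

/-- The derivation `∂/∂x_v`, as a linear endomorphism. -/
noncomputable def pderivEnd {σ : Type*} (v : σ) : Module.End ℂ (MvPolynomial σ ℂ) :=
  (pderiv v).toLinearMap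

/-- Multiplication by `x_v`, as a linear endomorphism. -/
noncomputable def mulXEnd {σ : Type*} (v : σ) : Module.End ℂ (MvPolynomial σ ℂ) :=
  LinearMap.mulLeft ℂ (X v)

theorem pderivEnd_apply {σ : Type*} (v : σ) (P : MvPolynomial σ ℂ) :
    pderivEnd v P = pderiv v P := rfl

theorem mulXEnd_apply {σ : Type*} (v : σ) (P : MvPolynomial σ ℂ) :
    mulXEnd v P = X v * P := rfl

theorem pderivEnd_lie_mulXEnd {σ : Type*} [DecidableEq σ] (v w : σ) :
    ⁅pderivEnd v, mulXEnd w⁆ = if v = w then 1 else 0 := by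
  refine LinearMap.ext fun P => ?_
  rw [Ring.lie_def]
  split_ifs with h
  · subst h
    simp [pderivEnd_apply, mulXEnd_apply]
  · simp [pderivEnd_apply, mulXEnd_apply, pderiv_X_of_ne (Ne.symm h)]

theorem pderivEnd_lie_pderivEnd {σ : Type*} (v w : σ) :
    ⁅pderivEnd v, (pderivEnd w : Module.End ℂ (MvPolynomial σ ℂ))⁆ = 0 := by
  classical
  have h : ⁅(pderiv v : Derivation ℂ (MvPolynomial σ ℂ) (MvPolynomial σ ℂ)),
      (pderiv w : Derivation ℂ (MvPolynomial σ ℂ) (MvPolynomial σ ℂ))⁆ = 0 := by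
    apply MvPolynomial.derivation_ext
    intro i
    simp [Derivation.commutator_apply, pderiv_X, Pi.single_apply, apply_ite]
  refine LinearMap.ext fun P => ?_
  simpa [Derivation.commutator_apply, Ring.lie_def, pderivEnd_apply] using
    congrArg (fun D => D P) h

theorem mulXEnd_lie_mulXEnd {σ : Type*} (v w : σ) : ⁅mulXEnd v, mulXEnd w⁆ = 0 := by
  refine LinearMap.ext fun P => ?_
  simp only [Ring.lie_def, LinearMap.sub_apply, Module.End.mul_apply, mulXEnd_apply,
    LinearMap.zero_apply]
  ring

theorem mulXEnd_lie_pderivEnd {σ : Type*} [DecidableEq σ] (v w : σ) :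
    ⁅mulXEnd w, pderivEnd v⁆ = if v = w then -1 else 0 := by
  rw [← lie_skew, pderivEnd_lie_mulXEnd]
  split_ifs <;> simp

theorem finite_pderivEnd_ne_zero {σ : Type*} (P : MvPolynomial σ ℂ) (f : ℤ → σ)
    (hf : Function.Injective f) : {q | pderivEnd (f q) P ≠ 0}.Finite := by
  classical
  refine (P.vars.finite_toSet.preimage hf.injOn).subset fun q hq => ?_
  by_contra h
  exact hq (pderiv_eq_zero_of_notMem_vars h)

variable {n : ℕ}

theorem aOp_eq (r : ℕ) (k l : Fin n) (m : ℤ) :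
    aOp n r k l m = if 0 ≤ m ∧ (l : ℕ) + 1 ≤ r then pderivEnd (Sum.inl (k, l, m))
      else mulXEnd (Sum.inl (k, l, m)) := rfl

theorem aStar_eq (r : ℕ) (k l : Fin n) (m : ℤ) :
    aStar n r k l m = if m ≤ 0 ∧ (l : ℕ) + 1 ≤ r then mulXEnd (Sum.inl (k, l, -m))
      else -pderivEnd (Sum.inl (k, l, -m)) := rfl

theorem aOp_lie_aOp (r : ℕ) (k l k' l' : Fin n) (q s : ℤ) :
    ⁅aOp n r k l q, aOp n r k' l' s⁆ = 0 := by
  simp only [aOp_eq]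
  split_ifs <;>
    simp only [pderivEnd_lie_mulXEnd, mulXEnd_lie_pderivEnd, pderivEnd_lie_pderivEnd,
      mulXEnd_lie_mulXEnd, Sum.inl.injEq, Prod.mk.injEq] <;>
    grind

theorem aStar_lie_aStar (r : ℕ) (k l k' l' : Fin n) (q s : ℤ) :
    ⁅aStar n r k l q, aStar n r k' l' s⁆ = 0 := by
  simp only [aStar_eq]
  split_ifs <;>
    simp only [lie_neg, neg_lie, pderivEnd_lie_mulXEnd, mulXEnd_lie_pderivEnd,
      pderivEnd_lie_pderivEnd, mulXEnd_lie_mulXEnd, Sum.inl.injEq, Prod.mk.injEq, neg_zero] <;>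
    grind

theorem aOp_lie_aStar (r : ℕ) (k l k' l' : Fin n) (q s : ℤ) :
    ⁅aOp n r k l q, aStar n r k' l' s⁆ =
      if k = k' ∧ l = l' ∧ q + s = 0 then 1 else 0 := by
  simp only [aOp_eq, aStar_eq]
  split_ifs <;>
    simp only [lie_neg, pderivEnd_lie_mulXEnd, mulXEnd_lie_pderivEnd, pderivEnd_lie_pderivEnd,
      mulXEnd_lie_mulXEnd, Sum.inl.injEq, Prod.mk.injEq] <;>
    grind

theorem bOp_lie_of_lie (e : Fin n → Fin n → ℂ) (lam : Fin n → ℂ) (i : Fin n) (m : ℤ)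
    (A : Module.End ℂ (PXY n)) (h₁ : ∀ v, ⁅(pderivEnd (Sum.inr v) : Module.End ℂ (PXY n)), A⁆ = 0)
    (h₂ : ∀ v, ⁅(mulXEnd (Sum.inr v) : Module.End ℂ (PXY n)), A⁆ = 0) :
    ⁅bOp n e lam i m, A⁆ = 0 := by
  have hsum (f : Fin n → ℂ) (T : Fin n → Module.End ℂ (PXY n)) (hT : ∀ k, ⁅T k, A⁆ = 0) :
      ⁅∑ k, f k • T k, A⁆ = 0 := by
    rw [sum_lie]
    exact Finset.sum_eq_zero fun k _ => by rw [end_smul_lie, hT, smul_zero]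
  unfold bOp
  split_ifs
  · exact (end_smul_lie _ _ _).trans
      ((congrArg _ (hsum _ _ fun k => h₁ _)).trans (smul_zero (m : ℂ)))
  · exact hsum _ _ fun k => h₂ _
  · rw [end_smul_lie, Ring.lie_def, one_mul, mul_one, sub_self, smul_zero]

theorem bOp_lie_aOp (r : ℕ) (e : Fin n → Fin n → ℂ) (lam : Fin n → ℂ) (i : Fin n) (m : ℤ)
    (k l : Fin n) (q : ℤ) : ⁅bOp n e lam i m, aOp n r k l q⁆ = 0 := by
  apply bOp_lie_of_lie <;> intro v <;> rw [aOp_eq] <;> split_ifs <;>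
    simp [pderivEnd_lie_mulXEnd, mulXEnd_lie_pderivEnd, pderivEnd_lie_pderivEnd,
      mulXEnd_lie_mulXEnd]

theorem bOp_lie_aStar (r : ℕ) (e : Fin n → Fin n → ℂ) (lam : Fin n → ℂ) (i : Fin n) (m : ℤ)
    (k l : Fin n) (q : ℤ) : ⁅bOp n e lam i m, aStar n r k l q⁆ = 0 := by
  apply bOp_lie_of_lie <;> intro v <;> rw [aStar_eq] <;> split_ifs <;>
    simp [pderivEnd_lie_mulXEnd, mulXEnd_lie_pderivEnd, pderivEnd_lie_pderivEnd,
      mulXEnd_lie_mulXEnd]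

/-- The pointwise sum of a locally finite family of endomorphisms. -/
noncomputable def sumEnd {V : Type*} [AddCommGroup V] [Module ℂ V] (T : ℤ → Module.End ℂ V)
    (hT : ∀ v, (Function.support fun q => T q v).Finite) : Module.End ℂ V where
  toFun v := ∑ᶠ q, T q v
  map_add' v w := by
    simp only [map_add]
    exact finsum_add_distrib (hT v) (hT w)
  map_smul' c v := by
    simp only [map_smul, RingHom.id_apply]
    exact (smul_finsum' c (hT v)).symm

theorem sumEnd_apply {V : Type*} [AddCommGroup V] [Module ℂ V] (T : ℤ → Module.End ℂ V)
    (hT : ∀ v, (Function.support fun q => T q v).Finite) (v : V) :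
    sumEnd T hT v = ∑ᶠ q, T q v := rfl

theorem lie_sumEnd_apply {V : Type*} [AddCommGroup V] [Module ℂ V] (T : ℤ → Module.End ℂ V)
    (hT : ∀ v, (Function.support fun q => T q v).Finite) (D : Module.End ℂ V) (v : V) :
    ⁅D, sumEnd T hT⁆ v = ∑ᶠ q, ⁅D, T q⁆ v := by
  have h : (Function.support fun q => D (T q v)).Finite :=
    (hT v).subset fun q hq h0 => hq (by simp only at h0 ⊢; rw [h0, map_zero])
  have hD : D (∑ᶠ q, T q v) = ∑ᶠ q, D (T q v) := D.toAddMonoidHom.map_finsum (hT v)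
  simp only [Ring.lie_def, LinearMap.sub_apply, Module.End.mul_apply, sumEnd_apply]
  rw [hD, finsum_sub_distrib h (hT (D v))]

/-- The normally ordered product `:a_{kl,q} a*_{k'l,m-q}:`. -/
noncomputable def normalTerm (r : ℕ) (k k' l : Fin n) (m q : ℤ) : Module.End ℂ (PXY n) :=
  if 0 ≤ q ∧ (l : ℕ) + 1 ≤ r then aStar n r k' l (m - q) * aOp n r k l q
  else aOp n r k l q * aStar n r k' l (m - q)

theorem normalTerm_support_finite (r : ℕ) (k k' l : Fin n) (m : ℤ) (P : PXY n) :
    (Function.support fun q => normalTerm r k k' l m q P).Finite := by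
  have h₁ := finite_pderivEnd_ne_zero P (fun q : ℤ => (Sum.inl (k, l, q) : Idx n))
    (fun q s h => by simpa using h)
  have h₂ := finite_pderivEnd_ne_zero P (fun q : ℤ => (Sum.inl (k', l, -(m - q)) : Idx n))
    (fun q s h => by simpa using h)
  refine ((h₁.union h₂).union (Set.finite_Icc m 0)).subset fun q hq => ?_
  by_contra hn
  simp only [Set.mem_union, Set.mem_ofPred_eq, Set.mem_Icc, not_or, not_not] at hn
  obtain ⟨⟨hn₁, hn₂⟩, hn₃⟩ := hn
  apply hq
  simp only [normalTerm]
  split_ifs with hf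
  · simp [aOp_eq, hf, hn₁]
  · have : ¬ (m - q ≤ 0 ∧ (l : ℕ) + 1 ≤ r) := by
      rintro ⟨h, h'⟩
      exact hn₃ ⟨by omega, by by_contra; exact hf ⟨by omega, h'⟩⟩
    have hz : aStar n r k' l (m - q) P = 0 := by
      rw [aStar_eq, if_neg this]
      simpa using hn₂
    simp [hz]

/-- The operator `Σ_q :a_{kl,q} a*_{k'l,m-q}:`. -/
noncomputable def normalSum (r : ℕ) (k k' l : Fin n) (m : ℤ) : Module.End ℂ (PXY n) :=
  sumEnd (normalTerm r k k' l m) (normalTerm_support_finite r k k' l m)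

theorem Nop_eq_normalSum (r : ℕ) (k l : Fin n) (m : ℤ) (P : PXY n) :
    Nop n r k l m P = normalSum r k k l m P := by
  rw [normalSum, sumEnd_apply, Nop]
  refine finsum_congr fun q => ?_
  unfold normalTerm
  split_ifs <;> rfl

theorem normalTerm_of_ne (r : ℕ) {k k' : Fin n} (hk : k ≠ k') (l : Fin n) (m q : ℤ) :
    normalTerm r k k' l m q = aOp n r k l q * aStar n r k' l (m - q) := by
  have h := aOp_lie_aStar r k l k' l q (m - q)
  rw [if_neg (fun h => hk h.1), Ring.lie_def, sub_eq_zero] at h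
  unfold normalTerm
  split_ifs <;> simp [h]

theorem pairOp_eq_normalSum (r : ℕ) {k k' : Fin n} (hk : k ≠ k') (l : Fin n) (m : ℤ)
    (P : PXY n) : pairOp n r k l k' l m P = normalSum r k k' l m P := by
  rw [normalSum, sumEnd_apply, pairOp]
  refine finsum_congr fun q => ?_
  rw [normalTerm_of_ne r hk]
  rfl

theorem ring_lie_mul {R : Type*} [Ring R] (D A B : R) :
    ⁅D, A * B⁆ = ⁅D, A⁆ * B + A * ⁅D, B⁆ := by
  simp only [Ring.lie_def]
  noncomm_ring

theorem aOp_lie_normalTerm (r : ℕ) (k l k₀ l₀ : Fin n) (m p q : ℤ) :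
    ⁅aOp n r k l p, normalTerm r k₀ k₀ l₀ m q⁆ =
      if k = k₀ ∧ l = l₀ ∧ q = m + p then aOp n r k l (m + p) else 0 := by
  unfold normalTerm
  split_ifs <;> rw [ring_lie_mul, aOp_lie_aOp, aOp_lie_aStar] <;> grind

theorem aStar_lie_normalTerm (r : ℕ) (k l k₀ l₀ : Fin n) (m p q : ℤ) :
    ⁅aStar n r k l p, normalTerm r k₀ k₀ l₀ m q⁆ =
      if k = k₀ ∧ l = l₀ ∧ q = -p then -aStar n r k l (m + p) else 0 := by
  have h : ⁅aStar n r k l p, aOp n r k₀ l₀ q⁆ =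
      if k = k₀ ∧ l = l₀ ∧ q = -p then -1 else 0 := by
    rw [← lie_skew, aOp_lie_aStar]
    grind
  unfold normalTerm
  by_cases hc : k = k₀ ∧ l = l₀ ∧ q = -p
  · obtain ⟨rfl, rfl, rfl⟩ := hc
    simp only [and_self, if_true] at h ⊢
    split_ifs <;> simp only [ring_lie_mul, aStar_lie_aStar, h, zero_mul, mul_zero, zero_add,
      add_zero, sub_neg_eq_add]
    · exact LinearMap.ext fun P => map_neg (aStar n r k l (m + p)) P
    · exact LinearMap.ext fun P => rfl
  · rw [if_neg hc] at h ⊢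
    split_ifs <;> simp [ring_lie_mul, aStar_lie_aStar, h]

theorem normalSum_lie_aOp (r : ℕ) (k l k₀ l₀ : Fin n) (m p : ℤ) :
    ⁅normalSum r k₀ k₀ l₀ m, aOp n r k l p⁆ =
      if k = k₀ ∧ l = l₀ then -aOp n r k l (m + p) else 0 := by
  rw [← lie_skew]
  refine LinearMap.ext fun P => ?_
  rw [LinearMap.neg_apply, normalSum, lie_sumEnd_apply,
    finsum_eq_single _ (m + p) fun q hq => by simp [aOp_lie_normalTerm, hq]]
  rw [aOp_lie_normalTerm]
  split_ifs <;> simp_all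

theorem normalSum_lie_aStar (r : ℕ) (k l k₀ l₀ : Fin n) (m p : ℤ) :
    ⁅normalSum r k₀ k₀ l₀ m, aStar n r k l p⁆ =
      if k = k₀ ∧ l = l₀ then aStar n r k l (m + p) else 0 := by
  rw [← lie_skew]
  refine LinearMap.ext fun P => ?_
  rw [LinearMap.neg_apply, normalSum, lie_sumEnd_apply,
    finsum_eq_single _ (-p) fun q hq => by simp [aStar_lie_normalTerm, hq]]
  rw [aStar_lie_normalTerm]
  split_ifs <;> simp_all

/-- `ρ(H_i)_m` as a linear endomorphism. -/
noncomputable def rhoHEnd (r : ℕ) (e : Fin n → Fin n → ℂ) (lam : Fin n → ℂ) (i : Fin n) (m : ℤ) :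
    Module.End ℂ (PXY n) :=
  (∑ k : Fin n, ∑ l : Fin n,
    (if k ≤ l then (pairRoot n i k l : ℂ) else 0) • normalSum r k k l m) + bOp n e lam i m

theorem rhoH_eq_rhoHEnd (r : ℕ) (e : Fin n → Fin n → ℂ) (lam : Fin n → ℂ) (i : Fin n) (m : ℤ)
    (P : PXY n) : rhoH n r e lam i m P = rhoHEnd r e lam i m P := by
  simp only [rhoH, rhoHEnd, Hcal, LinearMap.add_apply, LinearMap.sum_apply, LinearMap.smul_apply,
    Nop_eq_normalSum]
  congr 1
  refine Finset.sum_congr rfl fun k _ => Finset.sum_congr rfl fun l _ => ?_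
  split_ifs
  · rfl
  · rw [zero_smul]

theorem sum_smul_lie_of_ite {V : Type*} [AddCommGroup V] [Module ℂ V] (c : Fin n → Fin n → ℂ)
    (S : Fin n → Fin n → Module.End ℂ V) {A B : Module.End ℂ V} {k l : Fin n}
    (h : ∀ k₀ l₀, ⁅S k₀ l₀, A⁆ = if k = k₀ ∧ l = l₀ then B else 0) :
    ⁅∑ k₀, ∑ l₀, c k₀ l₀ • S k₀ l₀, A⁆ = c k l • B := by
  simp only [sum_lie, end_smul_lie, h]
  simp [ite_and]

theorem rhoHEnd_lie_aOp (r : ℕ) (e : Fin n → Fin n → ℂ) (lam : Fin n → ℂ) (i : Fin n) (m : ℤ)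
    {k l : Fin n} (hkl : k ≤ l) (p : ℤ) :
    ⁅rhoHEnd r e lam i m, aOp n r k l p⁆ = (-(pairRoot n i k l : ℂ)) • aOp n r k l (m + p) := by
  rw [rhoHEnd, add_lie, bOp_lie_aOp, add_zero,
    sum_smul_lie_of_ite _ _ (fun _ _ => normalSum_lie_aOp r _ _ _ _ _ _), if_pos hkl, smul_neg]
  exact (neg_smul _ _).symm

theorem rhoHEnd_lie_aStar (r : ℕ) (e : Fin n → Fin n → ℂ) (lam : Fin n → ℂ) (i : Fin n) (m : ℤ)
    {k l : Fin n} (hkl : k ≤ l) (p : ℤ) :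
    ⁅rhoHEnd r e lam i m, aStar n r k l p⁆ = (pairRoot n i k l : ℂ) • aStar n r k l (m + p) := by
  rw [rhoHEnd, add_lie, bOp_lie_aStar, add_zero,
    sum_smul_lie_of_ite _ _ (fun _ _ => normalSum_lie_aStar r _ _ _ _ _ _), if_pos hkl]

theorem rhoHEnd_lie_normalSum (r : ℕ) (e : Fin n → Fin n → ℂ) (lam : Fin n → ℂ) (i : Fin n)
    {k k' l : Fin n} (hne : k ≠ k') (hk : k ≤ l) (hk' : k' ≤ l) (m p : ℤ) :
    ⁅rhoHEnd r e lam i m, normalSum r k k' l p⁆ =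
      (-(pairRoot n i k l : ℂ) + pairRoot n i k' l) • normalSum r k k' l (m + p) := by
  refine LinearMap.ext fun P => ?_
  have hshift : ∑ᶠ q, normalTerm r k k' l (m + p) (m + q) P = normalSum r k k' l (m + p) P :=
    finsum_comp_equiv (Equiv.addLeft m) (f := fun q => normalTerm r k k' l (m + p) q P)
  have hfin : (Function.support fun q => normalTerm r k k' l (m + p) (m + q) P).Finite :=
    (normalTerm_support_finite r k k' l (m + p) P).preimage (add_right_injective m).injOn
  have hterm (q : ℤ) : ⁅rhoHEnd r e lam i m, normalTerm r k k' l p q⁆ P =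
      (-(pairRoot n i k l : ℂ)) • normalTerm r k k' l (m + p) (m + q) P +
        (pairRoot n i k' l : ℂ) • normalTerm r k k' l (m + p) q P := by
    simp only [normalTerm_of_ne r hne, ring_lie_mul, rhoHEnd_lie_aOp r e lam i m hk,
      rhoHEnd_lie_aStar r e lam i m hk', LinearMap.add_apply, smul_mul_assoc, mul_smul_comm,
      LinearMap.smul_apply, add_sub_add_left_eq_sub]
    rw [add_sub_assoc]
  have hfin' := normalTerm_support_finite r k k' l (m + p) P
  rw [normalSum, lie_sumEnd_apply, finsum_congr hterm, finsum_add_distrib, ← smul_finsum' _ hfin,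
    ← smul_finsum' _ hfin', hshift, ← sumEnd_apply _ (normalTerm_support_finite r k k' l (m + p)),
    LinearMap.smul_apply, add_smul]
  · rfl
  · exact hfin.subset fun q hq h0 => hq (by simp only at h0 ⊢; rw [h0, smul_zero])
  · exact hfin'.subset fun q hq h0 => hq (by simp only at h0 ⊢; rw [h0, smul_zero])

theorem pairRoot_self (i j : Fin n) : pairRoot n i j j = cartan n i j := by
  simp [pairRoot]

theorem pairRoot_eq_add (i : Fin n) {j j' l : Fin n} (hj : (j' : ℕ) = j + 1) (hl : j < l) :
    pairRoot n i j l = cartan n i j + pairRoot n i j' l := by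
  have h : Finset.Icc j l = insert j (Finset.Icc j' l) := by
    ext s
    simp only [Finset.mem_Icc, Finset.mem_insert, Fin.ext_iff, Fin.le_def, Fin.lt_def] at *
    omega
  rw [pairRoot, h, Finset.sum_insert, pairRoot]
  simp only [Finset.mem_Icc, Fin.le_def]
  omega

/-- `ρ(F_j)_p` as a linear endomorphism. -/
noncomputable def rhoFEnd (r : ℕ) (j : Fin n) (p : ℤ) : Module.End ℂ (PXY n) :=
  aOp n r j j p + ∑ l : Fin n, if h : j < l then
    normalSum r j (⟨(j : ℕ) + 1, by have := l.isLt; have := Fin.lt_def.mp h; omega⟩ : Fin n) l p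
  else 0

theorem rhoF_eq_rhoFEnd (r : ℕ) (j : Fin n) (p : ℤ) (P : PXY n) :
    rhoF n r j p P = rhoFEnd r j p P := by
  rw [rhoF, rhoFEnd, sumF, LinearMap.add_apply, LinearMap.sum_apply]
  congr 1
  refine Finset.sum_congr rfl fun l _ => ?_
  split_ifs
  · exact pairOp_eq_normalSum r (by simp [Fin.ext_iff]) l p P
  · rfl

theorem rhoHEnd_lie_rhoFEnd (r : ℕ) (e : Fin n → Fin n → ℂ) (lam : Fin n → ℂ) (i j : Fin n)
    (m p : ℤ) : ⁅rhoHEnd r e lam i m, rhoFEnd r j p⁆ =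
      (-(cartan n i j : ℂ)) • rhoFEnd r j (m + p) := by
  rw [rhoFEnd, rhoFEnd, lie_add, lie_sum, smul_add, Finset.smul_sum,
    rhoHEnd_lie_aOp r e lam i m le_rfl, pairRoot_self]
  congr 1
  refine Finset.sum_congr rfl fun l _ => ?_
  split_ifs with h
  · rw [rhoHEnd_lie_normalSum r e lam i (by simp [Fin.ext_iff]) h.le
        (by simp only [Fin.le_def] at *; omega),
      pairRoot_eq_add i (j' := ⟨(j : ℕ) + 1, by omega⟩) rfl h]
    congr 1
    push_cast
    ring
  · rw [lie_zero, smul_zero]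

end

/-- R3: `[ρ(H_i)_m, ρ(F_j)_p] = −(α_i|α_j) ρ(F_j)_{m+p}`. -/
theorem wakimoto_R3 (n r : ℕ) (hn : 1 ≤ n) (hr : r ≤ n)
    (γ : ℂ) (hγ : γ ≠ 0) (e : Fin n → Fin n → ℂ) (lam : Fin n → ℂ)
    (he : ∀ i j, ∑ k, e i k * e j k = Bmat n r γ i j)
    (i j : Fin n) (m p : ℤ) (P : PXY n) :
    rhoH n r e lam i m (rhoF n r j p P) - rhoF n r j p (rhoH n r e lam i m P) =
      (-(cartan n i j : ℂ)) • rhoF n r j (m + p) P := by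
  simp only [rhoH_eq_rhoHEnd, rhoF_eq_rhoFEnd]
  exact congrArg (fun D => D P) (rhoHEnd_lie_rhoFEnd r e lam i j m p)
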